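/- arXiv:2212.13549 — 2 statements merged into one kernel-verified Lean document; each statement's English description precedes it below -/
import Mathlib

section
/- Let (M,d) be a bounded metric space with metric normal structure such that the family A(M) of admissible subsets is compact, and let T : M → M be orbit-nonexpansive. Then T has a fixed point; moreover, the fixed point set Fix(T) is a one-local retract of M. -/
open Metric Set

/-- The orbit of `x` under `T`: `{x} ∪ {Tⁿ x : n ≥ 1}`. -/
def orbitOf {M : Type*} (T : M → M) (x : M) : Set M :=
  Set.range fun n : ℕ => T^[n] x

/-- `D(x,A) = sup { d(x,a) : a ∈ A }`. -/
noncomputable def Dsup {M : Type*} [MetricSpace M] (x : M) (A : Set M) : ℝ :=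
  sSup (dist x '' A)

/-- A self-map `T` is orbit-nonexpansive if `d(Tx,Ty) ≤ D(x, o_T(y))` for all `x,y`. -/
def OrbitNonexpansive {M : Type*} [MetricSpace M] (T : M → M) : Prop :=
  ∀ x y : M, dist (T x) (T y) ≤ Dsup x (orbitOf T y)

/-- A set is admissible if it is an intersection of closed balls. -/
def Admissible {M : Type*} [MetricSpace M] (A : Set M) : Prop :=
  ∃ C : Set (M × ℝ), A = ⋂ p ∈ C, Metric.closedBall p.1 p.2

/-- The family of admissible sets is compact: any collection of admissible sets whose
finite subcollections have nonempty intersection has nonempty intersection. -/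
def AdmissibleCompact (M : Type*) [MetricSpace M] : Prop :=
  ∀ 𝒞 : Set (Set M), (∀ A ∈ 𝒞, Admissible A) →
    (∀ 𝒟 ⊆ 𝒞, 𝒟.Finite → (⋂₀ 𝒟).Nonempty) → (⋂₀ 𝒞).Nonempty

/-- Metric normal structure: every admissible set with more than one point contains a
point `z` with `D(z,A) < δ(A)`. -/
def MetricNormalStructure (M : Type*) [MetricSpace M] : Prop :=
  ∀ A : Set M, Admissible A → A.Nontrivial → ∃ z ∈ A, Dsup z A < Metric.diam A

/-- `D` is a one-local retract of `M`: any family of closed balls centered in `D` with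
nonempty intersection meets `D`. -/
def OneLocalRetract {M : Type*} [MetricSpace M] (D : Set M) : Prop :=
  ∀ C : Set (M × ℝ), (∀ p ∈ C, p.1 ∈ D) →
    (⋂ p ∈ C, Metric.closedBall p.1 p.2).Nonempty →
    ((⋂ p ∈ C, Metric.closedBall p.1 p.2) ∩ D).Nonempty

/-- A family `F` of self-maps is interlaced orbit-nonexpansive if
`d(Tx,Sy) ≤ sup { D(x, o_R(y)) : R ∈ F }` for all `T,S ∈ F` and `x,y ∈ M`. -/
def InterlacedFamily {M : Type*} [MetricSpace M] (F : Set (M → M)) : Prop :=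
  ∀ T ∈ F, ∀ S ∈ F, ∀ x y : M,
    dist (T x) (S y) ≤ sSup ((fun R => Dsup x (orbitOf R y)) '' F)

/-- `B[A,r] = ⋂_{x ∈ A} B̄(x,r)`. -/
def Bball {M : Type*} [MetricSpace M] (A : Set M) (r : ℝ) : Set M :=
  ⋂ x ∈ A, Metric.closedBall x r

theorem orbitOf_subset {M : Type*} {T : M → M} {A : Set M} (hA : MapsTo T A A) {x : M} (hx : x ∈ A) :
    orbitOf T x ⊆ A := by
  rintro _ ⟨n, rfl⟩
  exact hA.iterate n hx

section Admissible

variable {M : Type*} [MetricSpace M]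

/-- A set is admissible iff it contains every point lying in all closed balls around it. -/
theorem admissible_iff_forall_closedBall {A : Set M} :
    Admissible A ↔
      ∀ x, (∀ c r, A ⊆ closedBall c r → x ∈ closedBall c r) → x ∈ A := by
  constructor
  · rintro ⟨C, rfl⟩ x hx
    simp only [mem_iInter]
    exact fun p hp => hx p.1 p.2 (biInter_subset_of_mem hp)
  · intro h
    refine ⟨{p | A ⊆ closedBall p.1 p.2}, Subset.antisymm (subset_iInter₂ fun p hp => hp) ?_⟩
    intro x hx
    simp only [mem_iInter] at hx
    exact h x fun c r hcr => hx (c, r) hcr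

theorem Admissible.sInter {𝒞 : Set (Set M)} (h : ∀ A ∈ 𝒞, Admissible A) :
    Admissible (⋂₀ 𝒞) :=
  admissible_iff_forall_closedBall.2 fun x hx A hA =>
    admissible_iff_forall_closedBall.1 (h A hA) x fun c r hcr =>
      hx c r ((sInter_subset_of_mem hA).trans hcr)

theorem Admissible.inter {A B : Set M} (hA : Admissible A) (hB : Admissible B) :
    Admissible (A ∩ B) := by
  rw [← sInter_pair]
  exact Admissible.sInter (by simp [hA, hB])

theorem admissible_Bball (A : Set M) (r : ℝ) : Admissible (Bball A r) :=
  admissible_iff_forall_closedBall.2 fun _ hx => mem_iInter₂.2 fun a ha =>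
    hx a r (biInter_subset_of_mem ha)

theorem mem_Bball {A : Set M} {r : ℝ} {x : M} : x ∈ Bball A r ↔ ∀ a ∈ A, dist x a ≤ r := by
  simp [Bball]

theorem dist_le_Dsup (hM : Bornology.IsBounded (univ : Set M)) {A : Set M} {x a : M}
    (ha : a ∈ A) : dist x a ≤ Dsup x A := by
  obtain ⟨K, hK⟩ := isBounded_iff.1 hM
  refine le_csSup ⟨K, ?_⟩ (mem_image_of_mem _ ha)
  rintro _ ⟨b, -, rfl⟩
  exact hK (mem_univ _) (mem_univ _)

theorem OrbitNonexpansive.dist_le_of_orbit {T : M → M} (hT : OrbitNonexpansive T) {x y : M}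
    {r : ℝ} (h : ∀ a ∈ orbitOf T y, dist x a ≤ r) : dist (T x) (T y) ≤ r := by
  refine (hT x y).trans (csSup_le ((range_nonempty _).image _) ?_)
  rintro _ ⟨a, ha, rfl⟩
  exact h a ha

theorem OrbitNonexpansive.dist_map_le {T : M → M} (hT : OrbitNonexpansive T) {x p : M}
    (hp : T p = p) : dist (T x) p ≤ dist x p := by
  have h : dist (T x) (T p) ≤ dist x p := hT.dist_le_of_orbit <| by
    rintro _ ⟨n, rfl⟩
    exact (congrArg (dist x) (Function.iterate_fixed hp n)).le
  rwa [hp] at h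

/-- Compactness provides minimal nonempty admissible invariant sets. -/
theorem AdmissibleCompact.exists_minimal_mapsTo (hcompact : AdmissibleCompact M) (T : M → M)
    {A : Set M} (hA : Admissible A) (hne : A.Nonempty) (hinv : MapsTo T A A) :
    ∃ B ⊆ A, Minimal (fun B => Admissible B ∧ B.Nonempty ∧ MapsTo T B B) B := by
  refine zorn_superset_nonempty {B | Admissible B ∧ B.Nonempty ∧ MapsTo T B B}
    (fun c hc hchain _ => ?_) A ⟨hA, hne, hinv⟩
  refine ⟨⋂₀ c, ⟨Admissible.sInter fun B hB => (hc hB).1, ?_, ?_⟩,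
    fun B hB => sInter_subset_of_mem hB⟩
  · refine hcompact c (fun B hB => (hc hB).1) fun 𝒟 h𝒟 hfin => ?_
    rcases 𝒟.eq_empty_or_nonempty with rfl | h𝒟ne
    · simpa using hne.mono (subset_univ A)
    · obtain ⟨B, hB⟩ := hfin.exists_minimal h𝒟ne
      refine (hc (h𝒟 hB.prop)).2.1.mono fun x hx E hE => ?_
      rcases hchain.total (h𝒟 hB.prop) (h𝒟 hE) with h | h
      · exact h hx
      · exact hB.le_of_le hE h hx
  · exact fun x hx B hB => (hc hB).2.2 (hx B hB)

/-- A minimal nonempty admissible invariant set is the admissible hull of its image. -/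
theorem subset_closedBall_of_minimal {T : M → M} {A : Set M}
    (hA : Minimal (fun B => Admissible B ∧ B.Nonempty ∧ MapsTo T B B) A) {c : M} {r : ℝ}
    (h : T '' A ⊆ closedBall c r) : A ⊆ closedBall c r := by
  obtain ⟨hadm, ⟨a, ha⟩, hinv⟩ := hA.prop
  let H : Set M := {x | ∀ c r, T '' A ⊆ closedBall c r → x ∈ closedBall c r}
  have himage : T '' A ⊆ H := fun y hy c r h => h hy
  have hHA : H ⊆ A := fun x hx => admissible_iff_forall_closedBall.1 hadm x fun c r hcr =>
    hx c r (hinv.image_subset.trans hcr)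
  have hH : Admissible H := admissible_iff_forall_closedBall.2 fun x hx c r h =>
    hx c r fun y hy => hy c r h
  have hAH : A ⊆ H := hA.le_of_le
    ⟨hH, ⟨T a, himage (mem_image_of_mem T ha)⟩,
      fun x hx => himage (mem_image_of_mem T (hHA hx))⟩ hHA
  exact fun x hx => hAH hx c r h

theorem OrbitNonexpansive.exists_fixed_mem (hM : Bornology.IsBounded (univ : Set M))
    (hns : MetricNormalStructure M) (hcompact : AdmissibleCompact M) {T : M → M}
    (hT : OrbitNonexpansive T) {A : Set M} (hA : Admissible A) (hne : A.Nonempty)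
    (hinv : MapsTo T A A) : ∃ x ∈ A, T x = x := by
  obtain ⟨B, hBA, hB⟩ := hcompact.exists_minimal_mapsTo T hA hne hinv
  obtain ⟨hadm, ⟨x, hx⟩, hBinv⟩ := hB.prop
  rcases B.subsingleton_or_nontrivial with hsub | hnt
  · exact ⟨x, hBA hx, hsub (hBinv hx) hx⟩
  obtain ⟨z, hz, hzlt⟩ := hns B hadm hnt
  have hzmem : z ∈ Bball B (Dsup z B) := mem_Bball.2 fun a ha => dist_le_Dsup hM ha
  have hcenter : MapsTo T (B ∩ Bball B (Dsup z B)) (B ∩ Bball B (Dsup z B)) := by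
    rintro y ⟨hy, hyr⟩
    refine ⟨hBinv hy, mem_Bball.2 fun a ha => ?_⟩
    have hball : B ⊆ closedBall (T y) (Dsup z B) := by
      refine subset_closedBall_of_minimal hB ?_
      rintro _ ⟨b, hb, rfl⟩
      rw [mem_closedBall']
      exact hT.dist_le_of_orbit fun a ha => mem_Bball.1 hyr a (orbitOf_subset hBinv hb ha)
    exact mem_closedBall'.1 (hball ha)
  have hsub : B ⊆ B ∩ Bball B (Dsup z B) := hB.le_of_le
    ⟨hadm.inter (admissible_Bball B _), ⟨z, hz, hzmem⟩, hcenter⟩ inter_subset_left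
  refine absurd hzlt (not_lt.2 (diam_le_of_forall_dist_le ?_ fun y hy a ha =>
    mem_Bball.1 (hsub hy).2 a ha))
  exact dist_nonneg.trans (dist_le_Dsup hM hz)

end Admissible

theorem stmt3 {M : Type*} [MetricSpace M] [Nonempty M]
    (hM : Bornology.IsBounded (Set.univ : Set M))
    (hns : MetricNormalStructure M) (hcompact : AdmissibleCompact M)
    (T : M → M) (hT : OrbitNonexpansive T) :
    (∃ x : M, T x = x) ∧ OneLocalRetract {x : M | T x = x} := by
  constructor
  · have huniv : Admissible (univ : Set M) := ⟨∅, by simp⟩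
    obtain ⟨x, -, hx⟩ :=
      hT.exists_fixed_mem hM hns hcompact huniv univ_nonempty (mapsTo_univ T univ)
    exact ⟨x, hx⟩
  · intro C hC hne
    obtain ⟨x, hx, hfix⟩ := hT.exists_fixed_mem hM hns hcompact ⟨C, rfl⟩ hne fun x hx =>
      mem_iInter₂.2 fun p hp => (hT.dist_map_le (hC p hp)).trans (mem_iInter₂.1 hx p hp)
    exact ⟨x, hx, hfix⟩
end

section
/- If a bounded metric space (M,d) has uniform normal structure with parameter c ∈ (0,1), then M has uniform relative normal structure with the same parameter c. -/
open Metric Set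

theorem dist_le_Dsup_s11 {M : Type*} [MetricSpace M] {A : Set M} (hA : Bornology.IsBounded A)
    (x : M) {z : M} (hz : z ∈ A) : dist x z ≤ Dsup x A := by
  obtain ⟨r, hr⟩ := hA.subset_closedBall x
  refine le_csSup ⟨r, ?_⟩ (mem_image_of_mem _ hz)
  rintro _ ⟨a, ha, rfl⟩
  simpa [dist_comm] using hr ha

theorem stmt11 {M : Type*} [MetricSpace M]
    (hM : Bornology.IsBounded (Set.univ : Set M))
    (c : ℝ) (hc0 : 0 < c) (hc1 : c < 1)
    (huns : ∀ A : Set M, Admissible A → A.Nontrivial →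
      ∃ x ∈ A, Dsup x A < c * Metric.diam A) :
    ∀ A : Set M, Admissible A → 0 < Metric.diam A →
      ∃ z : M, Dsup z A ≤ c * Metric.diam A ∧
        ∀ x : M, Dsup x A ≤ c * Metric.diam A → dist x z ≤ c * Metric.diam A := by
  intro A hA hd
  have hnt : A.Nontrivial := by
    by_contra h
    exact hd.ne' (Metric.diam_subsingleton (Set.not_nontrivial_iff.mp h))
  obtain ⟨z, hz, hzA⟩ := huns A hA hnt
  exact ⟨z, hzA.le, fun x hx => (dist_le_Dsup_s11 (hM.subset (subset_univ A)) x hz).trans hx⟩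
end
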